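/- arXiv:2005.09785 — 3 statements merged into one kernel-verified Lean document; each statement's English description precedes it below -/
import Mathlib

section
/- Let G be a group generated by a finite symmetric generating set S equipped with a linear order, and suppose G is shortlex combable with constant K ≥ 1. For each a ∈ G let A = {h ∈ G : h ≤ a} be the corresponding (finite) initial segment of the shortlex order on G, let m = max{|h| : h ∈ A}, and define P_A : G → G by: P_A(g) = g if g ∈ A; P_A(g) = g_m if g ∉ A and g_m ∈ A; and P_A(g) = g_{m−1} otherwise. Then: (i) P_A(g) ∈ A for every g ∈ G and P_A(h) = h for every h ∈ A (P_A is a retraction onto A); (ii) for any two elements a, b ∈ G with corresponding initial segments A, B one has P_A ∘ P_B = P_B ∘ P_A; and (iii) each P_A is (K+1)-Lipschitz with respect to the word metric: d_S(P_A(g), P_A(h)) ≤ (K+1)·d_S(g,h) for all g,h ∈ G. -/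
open scoped Classical

/-- The word metric associated with a generating set `S`: the least length of a word with
letters in `S` whose product is `g⁻¹ * h`. -/
noncomputable def wordDist {G : Type*} [Group G] (S : Finset G) (g h : G) : ℕ :=
  sInf {k : ℕ | ∃ l : List G, (∀ x ∈ l, x ∈ S) ∧ l.length = k ∧ l.prod = g⁻¹ * h}

/-- Evaluation in `G` of a word over the alphabet `S`. -/
def evalWord {G : Type*} [Group G] {S : Finset G} (l : List {x // x ∈ S}) : G :=
  (l.map Subtype.val).prod

/-- A word is reduced if no two consecutive letters are mutually inverse (as group elements). -/
def IsReducedWord {G : Type*} [Group G] {S : Finset G} (l : List {x // x ∈ S}) : Prop :=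
  List.Chain' (fun a b : {x // x ∈ S} => (b : G) ≠ (a : G)⁻¹) l

/-- The (non-strict) shortlex order on words induced by a strict order `lt` on the letters:
`w ⪯ v` iff `w` is shorter than `v`, or they have the same length and `w = v` or `w` precedes
`v` lexicographically. -/
def ShortLexLe {α : Type*} (lt : α → α → Prop) (w v : List α) : Prop :=
  w.length < v.length ∨ (w.length = v.length ∧ (w = v ∨ List.Lex lt w v))

theorem aux_lex_trans {α : Type*} {lt : α → α → Prop} (ht : ∀ a b c, lt a b → lt b c → lt a c) :
    ∀ {u v x : List α}, List.Lex lt u v → List.Lex lt v x → List.Lex lt u x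
  | _, _, _, .nil, .rel _ => .nil
  | _, _, _, .nil, .cons _ => .nil
  | _, _, _, .rel h, .rel h' => .rel (ht _ _ _ h h')
  | _, _, _, .rel h, .cons _ => .rel h
  | _, _, _, .cons _, .rel h' => .rel h'
  | _, _, _, .cons h, .cons h' => .cons (aux_lex_trans ht h h')

theorem aux_lex_append {α : Type*} {lt : α → α → Prop} (hi : ∀ a, ¬ lt a a) (v : List α) :
    ∀ (u u' : List α), u.length = u'.length → List.Lex lt (u ++ v) (u' ++ v) → List.Lex lt u u'
  | [], [], _, h => by
    exfalso
    simp only [List.nil_append] at h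
    induction v with
    | nil => cases h
    | cons a v ih =>
      cases h with
      | rel h => exact hi _ h
      | cons h => exact ih h
  | [], _ :: _, h, _ => by simp at h
  | _ :: _, [], h, _ => by simp at h
  | a :: u, b :: u', hl, h => by
    simp only [List.cons_append] at h
    cases h with
    | rel h => exact .rel h
    | cons h => exact .cons (aux_lex_append hi v u u' (by simpa using hl) h)

theorem aux_eval_append {G : Type*} [Group G] {S : Finset G} (l l' : List {x // x ∈ S}) :
    evalWord (l ++ l') = evalWord l * evalWord l' := by
  simp [evalWord]

theorem aux_reduce {G : Type*} [Group G] {S : Finset G} (l : List {x // x ∈ S}) :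
    ∃ l' : List {x // x ∈ S}, IsReducedWord l' ∧ evalWord l' = evalWord l ∧
      (l' = l ∨ l'.length < l.length) := by
  induction l with
  | nil => exact ⟨[], List.IsChain.nil, rfl, Or.inl rfl⟩
  | cons a l ih =>
    obtain ⟨l', h1, h2, h3⟩ := ih
    have h3' : l'.length ≤ l.length := by
      rcases h3 with h | h
      · rw [h]
      · exact h.le
    cases l' with
    | nil =>
      refine ⟨[a], List.IsChain.singleton _, ?_, ?_⟩
      · simp only [evalWord, List.map_cons, List.prod_cons, List.map_nil, List.prod_nil] at h2 ⊢
        rw [← h2]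
      · rcases h3 with h | h
        · left; rw [h]
        · right; simpa using h
    | cons b t =>
      by_cases hb : (b : G) = (a : G)⁻¹
      · refine ⟨t, List.IsChain.tail h1, ?_, Or.inr ?_⟩
        · simp only [evalWord, List.map_cons, List.prod_cons] at h2 ⊢
          rw [← h2, hb]; simp
        · simp at h3' ⊢; omega
      · refine ⟨a :: b :: t, List.IsChain.cons_cons hb h1, ?_, ?_⟩
        · simp only [evalWord, List.map_cons, List.prod_cons] at h2 ⊢
          rw [← h2]
        · rcases h3 with h | h
          · left; rw [h]
          · right; simpa using h

/-- Let `G` be a group generated by a finite symmetric ordered set `S`,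
shortlex combable with constant `K ≥ 1`.  Here `w g` denotes the shortlex-least reduced word
representing `g`, `gle` the induced shortlex order on `G`, and `P a` the retraction of the paper
onto the initial segment `A = {h : h ≤ a}` (with `m = max {|h| : h ∈ A}`).  Then the maps `P a`
are retractions onto the initial segments, they pairwise commute, and each is
`(K+1)`-Lipschitz for the word metric. -/
theorem shortlex_combable_retractions
    {G : Type*} [Group G] (S : Finset G)
    (hsym : ∀ s ∈ S, s⁻¹ ∈ S)
    (hgen : Subgroup.closure (S : Set G) = ⊤)
    (lt : {x // x ∈ S} → {x // x ∈ S} → Prop)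
    (hlt : IsStrictTotalOrder {x // x ∈ S} lt)
    -- `w g` is the shortlex-least reduced word representing `g`
    (w : G → List {x // x ∈ S})
    (hred : ∀ g : G, IsReducedWord (w g))
    (heval : ∀ g : G, evalWord (w g) = g)
    (hmin : ∀ g : G, ∀ l : List {x // x ∈ S},
      IsReducedWord l → evalWord l = g → ShortLexLe lt (w g) l)
    -- the shortlex order on `G`
    (gle : G → G → Prop) (hgle : ∀ g h : G, gle g h ↔ ShortLexLe lt (w g) (w h))
    -- shortlex combability with constant `K ≥ 1`
    (K : ℕ) (hK : 1 ≤ K)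
    (hcomb : ∀ g h : G, wordDist S g h = 1 →
      ∀ i ≤ min (w g).length (w h).length,
        wordDist S (evalWord ((w g).take i)) (evalWord ((w h).take i)) ≤ K)
    -- the retractions `P a` onto the initial segments `A = {h : gle h a}`
    (P : G → G → G)
    (hP : ∀ a g : G,
      P a g =
        if gle g a then g
        else
          let m : ℕ := sSup {k : ℕ | ∃ h : G, gle h a ∧ (w h).length = k}
          if gle (evalWord ((w g).take m)) a then evalWord ((w g).take m)
          else evalWord ((w g).take (m - 1))) :
    (∀ a g : G, gle (P a g) a) ∧
    (∀ a h : G, gle h a → P a h = h) ∧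
    (∀ a b g : G, P a (P b g) = P b (P a g)) ∧
    (∀ a g h : G, wordDist S (P a g) (P a h) ≤ (K + 1) * wordDist S g h) := by
  have hirr : ∀ a, ¬ lt a a := fun a => hlt.toIrrefl.irrefl a
  have htr : ∀ a b c, lt a b → lt b c → lt a c := fun a b c => hlt.toIsTrans.trans a b c
  haveI := hlt
  have hasymm : ∀ u v : List {x // x ∈ S}, List.Lex lt u v → ¬ List.Lex lt v u :=
    fun u v => (List.Lex.asymm lt).asymm u v
  -- geodesic
  have hgeo : ∀ l : List {x // x ∈ S}, (w (evalWord l)).length ≤ l.length := by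
    intro l
    obtain ⟨l', h1, h2, h3⟩ := aux_reduce l
    have h := hmin _ l' h1 h2
    have : (w (evalWord l)).length ≤ l'.length := by
      rcases h with h | h
      · exact h.le
      · exact h.1.le
    rcases h3 with h | h
    · rwa [h] at this
    · omega
  have hgeored : ∀ l : List {x // x ∈ S}, l.length = (w (evalWord l)).length →
      IsReducedWord l := by
    intro l hl
    obtain ⟨l', h1, h2, h3⟩ := aux_reduce l
    rcases h3 with h | h
    · rwa [h] at h1
    · have := hgeo l'
      rw [h2] at this
      omega
  -- prefix closed
  have hpre : ∀ g i, w (evalWord ((w g).take i)) = (w g).take i := by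
    intro g i
    set u := (w g).take i with hu
    set v := (w g).drop i with hv
    have huv : u ++ v = w g := List.take_append_drop i (w g)
    have hle := hgeo u
    have he : evalWord (w (evalWord u) ++ v) = g := by
      rw [aux_eval_append, heval, ← aux_eval_append, huv, heval]
    have hlen1 : (w g).length ≤ (w (evalWord u) ++ v).length := by
      have := hgeo (w (evalWord u) ++ v)
      rwa [he] at this
    have hlen2 : (w g).length = u.length + v.length := by rw [← huv, List.length_append]
    have hlen : u.length = (w (evalWord u)).length := by
      rw [List.length_append] at hlen1
      omega
    have hr : IsReducedWord (w (evalWord u) ++ v) := by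
      apply hgeored
      rw [he, List.length_append]; omega
    have hr2 : IsReducedWord u := hgeored _ hlen
    have h1 := hmin g _ hr he
    have h2 := hmin (evalWord u) u hr2 rfl
    rcases h2 with h2 | ⟨-, h2 | h2⟩
    · omega
    · exact h2
    · rw [← huv] at h1
      rcases h1 with h1 | ⟨-, h1 | h1⟩
      · simp only [List.length_append] at h1; omega
      · exact (List.append_cancel_right h1).symm
      · exact absurd h2 (hasymm _ _ (aux_lex_append hirr v _ _ hlen h1))
  have hprelen : ∀ g i, i ≤ (w g).length → (w (evalWord ((w g).take i))).length = i := by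
    intro g i hi
    rw [hpre, List.length_take]; omega
  have hprefull : ∀ g, evalWord ((w g).take (w g).length) = g := by
    intro g; rw [List.take_length, heval]
  -- word metric
  have hd : ∀ g h, wordDist S g h = (w (g⁻¹ * h)).length := by
    intro g h
    unfold wordDist
    apply le_antisymm
    · apply Nat.sInf_le
      refine ⟨(w (g⁻¹ * h)).map Subtype.val, ?_, by simp, heval _⟩
      intro x hx
      obtain ⟨y, -, rfl⟩ := List.mem_map.1 hx
      exact y.2
    · apply le_csInf
      · refine ⟨_, (w (g⁻¹ * h)).map Subtype.val, ?_, rfl, heval _⟩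
        intro x hx
        obtain ⟨y, -, rfl⟩ := List.mem_map.1 hx
        exact y.2
      · rintro k ⟨l, hl, rfl, hprod⟩
        lift l to List {x // x ∈ S} using hl
        have := hgeo l
        unfold evalWord at this
        rw [hprod] at this
        simpa using this
  have hLmul : ∀ x y, (w (x * y)).length ≤ (w x).length + (w y).length := by
    intro x y
    have := hgeo (w x ++ w y)
    rwa [aux_eval_append, heval, heval, List.length_append] at this
  have hinv0 : ∀ l : List {x // x ∈ S}, ∃ l' : List {x // x ∈ S},
      l'.length = l.length ∧ evalWord l' = (evalWord l)⁻¹ := by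
    intro l
    induction l with
    | nil => exact ⟨[], rfl, by simp [evalWord]⟩
    | cons a l ih =>
      obtain ⟨l', h1, h2⟩ := ih
      refine ⟨l' ++ [⟨(a : G)⁻¹, hsym _ a.2⟩], by simp [h1], ?_⟩
      rw [aux_eval_append, h2]
      simp [evalWord]
  have hLinv : ∀ x, (w x⁻¹).length ≤ (w x).length := by
    intro x
    obtain ⟨l', h1, h2⟩ := hinv0 (w x)
    have := hgeo l'
    rwa [h2, heval, h1] at this
  have htri : ∀ x y z, wordDist S x z ≤ wordDist S x y + wordDist S y z := by
    intro x y z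
    rw [hd, hd, hd]
    have := hLmul (x⁻¹ * y) (y⁻¹ * z)
    rwa [show x⁻¹ * y * (y⁻¹ * z) = x⁻¹ * z by group] at this
  have hsymm : ∀ x y, wordDist S x y ≤ wordDist S y x := by
    intro x y
    rw [hd, hd]
    have := hLinv (y⁻¹ * x)
    rwa [show (y⁻¹ * x)⁻¹ = x⁻¹ * y by group] at this
  have hone : (w 1).length = 0 := by
    have := hgeo ([] : List {x // x ∈ S})
    simpa [evalWord] using this
  have hself : ∀ x, wordDist S x x = 0 := by
    intro x; rw [hd]; simpa using hone
  have hzero : ∀ x y, wordDist S x y = 0 → x = y := by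
    intro x y h
    rw [hd] at h
    have h1 := heval (x⁻¹ * y)
    rw [List.length_eq_zero_iff.1 h] at h1
    have h2 : x⁻¹ * y = 1 := by rw [← h1]; simp [evalWord]
    exact inv_mul_eq_one.1 h2
  have hlenstep : ∀ x y, (w y).length ≤ (w x).length + wordDist S x y := by
    intro x y
    rw [hd]
    have := hLmul x (x⁻¹ * y)
    rwa [mul_inv_cancel_left] at this
  have hsucc : ∀ g i, wordDist S (evalWord ((w g).take i)) (evalWord ((w g).take (i + 1))) ≤ 1 := by
    intro g i
    rw [hd]
    have : (w g).take (i+1) = (w g).take i ++ ((w g).drop i).take 1 := List.take_add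
    rw [this, aux_eval_append, inv_mul_cancel_left]
    refine (hgeo _).trans ?_
    rw [List.length_take]; omega
  -- the order on the group
  have hgrefl : ∀ a, gle a a := fun a => (hgle a a).2 (Or.inr ⟨rfl, Or.inl rfl⟩)
  have hglen : ∀ g a, gle g a → (w g).length ≤ (w a).length := by
    intro g a h
    rcases (hgle g a).1 h with h | h
    · exact h.le
    · exact h.1.le
  have hgoflen : ∀ g a, (w g).length < (w a).length → gle g a := fun g a h => (hgle g a).2 (Or.inl h)
  have hgtrans : ∀ a b c, gle a b → gle b c → gle a c := by
    intro a b c h1 h2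
    rw [hgle] at h1 h2 ⊢
    rcases h1 with h1 | ⟨h1, h1'⟩
    · left
      rcases h2 with h2 | ⟨h2, -⟩ <;> omega
    · rcases h2 with h2 | ⟨h2, h2'⟩
      · left; omega
      · right
        refine ⟨h1.trans h2, ?_⟩
        rcases h1' with h1' | h1'
        · rw [h1']; exact h2'
        · rcases h2' with h2' | h2'
          · rw [← h2']; exact Or.inr h1'
          · exact Or.inr (aux_lex_trans htr h1' h2')
  have hgtot : ∀ a b, gle a b ∨ gle b a := by
    intro a b
    rw [hgle, hgle]
    rcases lt_trichotomy (w a).length (w b).length with h | h | h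
    · exact Or.inl (Or.inl h)
    · by_cases h1 : List.Lex lt (w a) (w b)
      · exact Or.inl (Or.inr ⟨h, Or.inr h1⟩)
      · by_cases h2 : List.Lex lt (w b) (w a)
        · exact Or.inr (Or.inr ⟨h.symm, Or.inr h2⟩)
        · exact Or.inl (Or.inr ⟨h, Or.inl ((List.Lex.trichotomous lt).trichotomous _ _ h1 h2)⟩)
    · exact Or.inr (Or.inl h)
  have hm : ∀ a, sSup {k : ℕ | ∃ h : G, gle h a ∧ (w h).length = k} = (w a).length := by
    intro a
    apply IsGreatest.csSup_eq
    refine ⟨⟨a, hgrefl a, rfl⟩, ?_⟩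
    rintro k ⟨h, h1, rfl⟩
    exact hglen _ _ h1
  -- description of the retraction
  have key : ∀ a g, ∃ i, i ≤ (w g).length ∧ P a g = evalWord ((w g).take i) ∧ gle (P a g) a ∧
      ((gle g a ∧ i = (w g).length ∧ (w g).length ≤ (w a).length) ∨
       (¬ gle g a ∧ (w a).length ≤ (w g).length ∧ (i = (w a).length ∨ i = (w a).length - 1) ∧
          ((w g).length = (w a).length → i = (w a).length - 1))) ∧
      (∀ j ≤ (w g).length, gle (evalWord ((w g).take j)) a → j ≤ i) := by
    intro a g
    have hPa := hP a g
    simp only [hm] at hPa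
    by_cases h1 : gle g a
    · rw [if_pos h1] at hPa
      refine ⟨(w g).length, le_rfl, ?_, ?_, Or.inl ⟨h1, rfl, hglen _ _ h1⟩, fun j hj _ => hj⟩
      · rw [hPa, hprefull]
      · rw [hPa]; exact h1
    · rw [if_neg h1] at hPa
      have hge : (w a).length ≤ (w g).length := by
        by_contra hc
        exact h1 (hgoflen _ _ (by omega))
      by_cases h2 : gle (evalWord ((w g).take (w a).length)) a
      · rw [if_pos h2] at hPa
        refine ⟨(w a).length, hge, hPa, ?_, Or.inr ⟨h1, hge, Or.inl rfl, ?_⟩, ?_⟩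
        · rw [hPa]; exact h2
        · intro he
          rw [← he, hprefull] at h2
          exact absurd h2 h1
        · intro j hj hja
          have := hglen _ _ hja
          rwa [hprelen g j hj] at this
      · rw [if_neg h2] at hPa
        refine ⟨(w a).length - 1, by omega, hPa, ?_, Or.inr ⟨h1, hge, Or.inr rfl, fun _ => rfl⟩, ?_⟩
        · rw [hPa]
          have hpos : (w a).length ≠ 0 := by
            intro h0
            apply h2
            have ha : a = 1 := by
              rw [← heval a, List.length_eq_zero_iff.1 h0]; simp [evalWord]
            have : evalWord ((w g).take (w a).length) = a := by
              rw [h0, ha]; simp [evalWord]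
            rw [this]; exact hgrefl a
          apply hgoflen
          rw [hprelen _ _ (by omega)]; omega
        · intro j hj hja
          have h3 := hglen _ _ hja
          rw [hprelen g j hj] at h3
          have h4 : j ≠ (w a).length := by
            rintro rfl; exact h2 hja
          omega
  have hPmem : ∀ a g, gle (P a g) a := by
    intro a g
    obtain ⟨i, -, -, h, -⟩ := key a g
    exact h
  have hPfix : ∀ a h, gle h a → P a h = h := by
    intro a h hh
    rw [hP, if_pos hh]
  have hcomm : ∀ a b, gle a b → ∀ g, P a (P b g) = P b (P a g) := by
    intro a b hab g
    rw [hPfix b (P a g) (hgtrans _ _ _ (hPmem a g) hab)]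
    obtain ⟨i, hi, hiP, hia, -, himax⟩ := key a g
    obtain ⟨j, hj, hjP, hjb, -, hjmax⟩ := key b g
    obtain ⟨k, hk, hkP, hka, -, hkmax⟩ := key a (P b g)
    have hij : i ≤ j := hjmax i hi (by rw [← hiP]; exact hgtrans _ _ _ hia hab)
    have hwb : w (P b g) = (w g).take j := by rw [hjP, hpre]
    have hlb : (w (P b g)).length = j := by rw [hwb, List.length_take]; omega
    have htk : ∀ n, n ≤ j → (w (P b g)).take n = (w g).take n := by
      intro n hn
      rw [hwb, List.take_take, min_eq_left hn]
    rw [hlb] at hk hkmax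
    rw [htk k hk] at hkP
    have h1 : i ≤ k := hkmax i hij (by rw [htk i hij, ← hiP]; exact hia)
    have h2 : k ≤ i := himax k (hk.trans hj) (by rw [← hkP]; exact hka)
    rw [hkP, hiP, le_antisymm h1 h2]
  have hedge : ∀ a g h, wordDist S g h = 1 → wordDist S (P a g) (P a h) ≤ K + 1 := by
    intro a g h hgh
    obtain ⟨i, hi, hiP, -, hi2, -⟩ := key a g
    obtain ⟨j, hj, hjP, -, hj2, -⟩ := key a h
    have l1 := hlenstep g h
    have l2 := hlenstep h g
    have l3 := hsymm h g
    have hc := hcomb g h hgh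
    rw [hiP, hjP]
    have hcases : i = j ∨ i = j + 1 ∨ j = i + 1 := by
      rcases hi2 with ⟨-, a1, a2⟩ | ⟨-, a1, a2, a3⟩ <;>
      rcases hj2 with ⟨-, b1, b2⟩ | ⟨-, b1, b2, b3⟩ <;> omega
    rcases hcases with e | e | e
    · subst e
      exact (hc i (le_min hi hj)).trans (Nat.le_succ _)
    · subst e
      have h1 := hc j (le_min (by omega) hj)
      have h2 := (hsymm (evalWord ((w g).take (j+1))) (evalWord ((w g).take j))).trans (hsucc g j)
      have h3 := htri (evalWord ((w g).take (j+1))) (evalWord ((w g).take j))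
        (evalWord ((w h).take j))
      omega
    · subst e
      have h1 := hc i (le_min hi (by omega))
      have h2 := hsucc h i
      have h3 := htri (evalWord ((w g).take i)) (evalWord ((w h).take i))
        (evalWord ((w h).take (i+1)))
      omega
  have hlip : ∀ a, ∀ l : List {x // x ∈ S}, ∀ g,
      wordDist S (P a g) (P a (g * evalWord l)) ≤ (K + 1) * l.length := by
    intro a l
    induction l with
    | nil => intro g; simp [evalWord, hself]
    | cons s l ih =>
      intro g
      have h1 := ih (g * s)
      have he : g * evalWord (s :: l) = g * s * evalWord l := by
        simp [evalWord, mul_assoc]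
      rw [he]
      have h2 : wordDist S g (g * s) ≤ 1 := by
        rw [hd, inv_mul_cancel_left]
        have := hgeo [s]
        simpa [evalWord] using this
      have h3 : wordDist S (P a g) (P a (g * s)) ≤ K + 1 := by
        rcases Nat.le_one_iff_eq_zero_or_eq_one.1 h2 with h | h
        · rw [← hzero _ _ h, hself]; omega
        · exact hedge _ _ _ h
      have h4 := htri (P a g) (P a (g * s)) (P a (g * s * evalWord l))
      rw [List.length_cons, Nat.mul_succ]
      omega
  refine ⟨hPmem, hPfix, ?_, ?_⟩
  · intro a b g
    rcases hgtot a b with h | h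
    · exact hcomm a b h g
    · exact (hcomm b a h g).symm
  · intro a g h
    have := hlip a (w (g⁻¹ * h)) g
    rwa [heval, mul_inv_cancel_left, ← hd] at this
end

section
/- Let X be a metric space, K ≥ 0, and let p, x, y ∈ X with d(x,y) ≤ 1. Let m, n ≥ 0 be natural numbers and let g₀ = p, g₁, …, g_m = x and h₀ = p, h₁, …, h_n = y be geodesic sequences, i.e., d(g_i, g_j) = |i − j| for all 0 ≤ i,j ≤ m and d(h_i, h_j) = |i − j| for all 0 ≤ i,j ≤ n. Suppose the following thinness condition holds: for every 0 ≤ i ≤ m, either there exists 0 ≤ j ≤ n with d(g_i, h_j) ≤ K, or d(g_i, x) ≤ K, or d(g_i, y) ≤ K. Then for every i ≤ min(m, n), d(g_i, h_i) ≤ 2K + 2. -/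
/-- fellow-traveling of geodesics in a hyperbolic space.  If `g` and `h` are
geodesic sequences from `p` to `x` resp. `y` with `d(x,y) ≤ 1`, and every point of `g` is
`K`-close to a point of `h` or to `x` or to `y`, then `d(g_i, h_i) ≤ 2K + 2` for all
`i ≤ min(m, n)`. -/
theorem geodesics_fellow_travel
    {X : Type*} [MetricSpace X] (K : ℝ) (hK : 0 ≤ K)
    (p x y : X) (hxy : dist x y ≤ 1)
    (m n : ℕ) (g h : ℕ → X)
    (hg0 : g 0 = p) (hgm : g m = x) (hh0 : h 0 = p) (hhn : h n = y)
    (hggeo : ∀ i ≤ m, ∀ j ≤ m, dist (g i) (g j) = |(i : ℝ) - (j : ℝ)|)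
    (hhgeo : ∀ i ≤ n, ∀ j ≤ n, dist (h i) (h j) = |(i : ℝ) - (j : ℝ)|)
    (hthin : ∀ i ≤ m,
      (∃ j ≤ n, dist (g i) (h j) ≤ K) ∨ dist (g i) x ≤ K ∨ dist (g i) y ≤ K) :
    ∀ i ≤ min m n, dist (g i) (h i) ≤ 2 * K + 2 := by
  intro i hi
  have him : i ≤ m := le_trans hi (min_le_left _ _)
  have hin : i ≤ n := le_trans hi (min_le_right _ _)
  have key : ∃ j ≤ n, dist (g i) (h j) ≤ K + 1 := by
    rcases hthin i him with ⟨j, hj, hd⟩ | hd | hd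
    · exact ⟨j, hj, by linarith⟩
    · refine ⟨n, le_refl n, ?_⟩
      rw [hhn]
      linarith [dist_triangle (g i) x y]
    · refine ⟨n, le_refl n, ?_⟩
      rw [hhn]
      linarith
  obtain ⟨j, hj, hd⟩ := key
  have h1 : dist (g i) p = i := by
    rw [← hg0, hggeo i him 0 (Nat.zero_le m)]
    simp
  have h2 : dist (h j) p = j := by
    rw [← hh0, hhgeo j hj 0 (Nat.zero_le n)]
    simp
  have h3 : dist (h j) (h i) ≤ K + 1 := by
    rw [hhgeo j hj i hin, abs_le]
    have h4 := dist_triangle (g i) (h j) p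
    have h5 := dist_triangle (h j) (g i) p
    rw [dist_comm (h j) (g i)] at h5
    constructor <;> linarith
  linarith [dist_triangle (g i) (h j) (h i)]
end

section
/- Let n ≥ 1 and let G be the free group on n generators, with word metric d(g,h) := |g⁻¹h|, where |w| denotes the length of the reduced word of w ∈ G. Let E = {(g,h) ∈ G × G : d(g,h) = 1 and |g| = |h| + 1} be the set of directed edges of the Cayley graph pointing away from the identity. Then for every finitely supported function a : E → ℝ, the supremum of Σ_{(g,h) ∈ E} a(g,h)·(f(g) − f(h)), taken over all functions f : G → ℝ with f(1) = 0 and |f(u) − f(v)| ≤ d(u,v) for all u,v ∈ G, equals Σ_{(g,h) ∈ E} |a(g,h)|. -/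
theorem toWord_mul_letter {α : Type*} [DecidableEq α] (g : FreeGroup α) (s : α × Bool) :
    (g * FreeGroup.mk [s]).toWord = g.toWord ++ [s] ∨
      g.toWord = (g * FreeGroup.mk [s]).toWord ++ [(s.1, !s.2)] := by
  have hg : FreeGroup.IsReduced g.toWord := FreeGroup.isReduced_toWord
  have hgm : g = FreeGroup.mk g.toWord := FreeGroup.mk_toWord.symm
  generalize g.toWord = w at hg hgm
  subst hgm
  rcases List.eq_nil_or_concat' w with rfl | ⟨w', t, rfl⟩
  · left
    simp [FreeGroup.mul_mk, FreeGroup.reduce_singleton]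
  · by_cases h : t.1 = s.1 → t.2 = s.2
    · left
      rw [FreeGroup.mul_mk, FreeGroup.toWord_mk]
      apply FreeGroup.IsReduced.reduce_eq
      unfold FreeGroup.IsReduced at *
      rw [List.isChain_append]
      refine ⟨hg, by simp, ?_⟩
      simpa using h
    · right
      push Not at h
      obtain ⟨h1, h2⟩ := h
      have ht : t = (s.1, !s.2) := by
        refine Prod.ext (by exact h1) ?_
        revert h2
        show t.2 ≠ s.2 → t.2 = !s.2
        cases t.2 <;> cases s.2 <;> simp
      have hw' : FreeGroup.IsReduced w' := by
        unfold FreeGroup.IsReduced at *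
        exact (List.isChain_append.1 hg).1
      have h5 : FreeGroup.mk (w' ++ [t]) * FreeGroup.mk [s] = FreeGroup.mk w' := by
        rw [FreeGroup.mul_mk]
        apply Quot.sound
        subst ht
        have := @FreeGroup.Red.Step.not_rev α w' [] s.1 s.2
        simpa using this
      rw [h5, FreeGroup.toWord_mk, hw'.reduce_eq, ht]

/-- Sum of edge weights along the path from the identity to `g`. -/
noncomputable def treeSum {α : Type*} [DecidableEq α] (e : FreeGroup α → FreeGroup α → ℝ)
    (g : FreeGroup α) : ℝ :=
  ∑ k ∈ Finset.range g.toWord.length,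
    e (FreeGroup.mk (g.toWord.take (k + 1))) (FreeGroup.mk (g.toWord.take k))

theorem treeSum_of_append {α : Type*} [DecidableEq α] (e : FreeGroup α → FreeGroup α → ℝ)
    (g h : FreeGroup α) (s : α × Bool) (H : g.toWord = h.toWord ++ [s]) :
    treeSum e g = treeSum e h + e g h := by
  unfold treeSum
  have hl : g.toWord.length = h.toWord.length + 1 := by rw [H]; simp
  rw [hl, Finset.sum_range_succ]
  congr 1
  · apply Finset.sum_congr rfl
    intro k hk
    have hk := Finset.mem_range.1 hk
    rw [H, List.take_append_of_le_length (by omega), List.take_append_of_le_length (by omega)]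
  · rw [← hl, List.take_length, FreeGroup.mk_toWord, H, List.take_left, FreeGroup.mk_toWord]

theorem treeSum_letter {α : Type*} [DecidableEq α] (e : FreeGroup α → FreeGroup α → ℝ)
    (he : ∀ g h, |e g h| ≤ 1) (g : FreeGroup α) (s : α × Bool) :
    |treeSum e g - treeSum e (g * FreeGroup.mk [s])| ≤ 1 := by
  rcases toWord_mul_letter g s with h | h
  · rw [treeSum_of_append e _ _ _ h, sub_add_cancel_left, abs_neg]
    exact he _ _
  · rw [treeSum_of_append e _ _ _ h, add_sub_cancel_left]
    exact he _ _

theorem treeSum_list {α : Type*} [DecidableEq α] (e : FreeGroup α → FreeGroup α → ℝ)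
    (he : ∀ g h, |e g h| ≤ 1) (L : List (α × Bool)) (g : FreeGroup α) :
    |treeSum e g - treeSum e (g * FreeGroup.mk L)| ≤ L.length := by
  induction L generalizing g with
  | nil => simp [← FreeGroup.one_eq_mk]
  | cons s L ih =>
    have h1 := treeSum_letter e he g s
    have h2 := ih (g * FreeGroup.mk [s])
    rw [mul_assoc, FreeGroup.mul_mk, List.singleton_append] at h2
    have h3 := abs_sub_le (treeSum e g) (treeSum e (g * FreeGroup.mk [s]))
      (treeSum e (g * FreeGroup.mk (s :: L)))
    push_cast [List.length_cons]
    linarith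

theorem treeSum_lipschitz {α : Type*} [DecidableEq α] (e : FreeGroup α → FreeGroup α → ℝ)
    (he : ∀ g h, |e g h| ≤ 1) (u v : FreeGroup α) :
    |treeSum e u - treeSum e v| ≤ ((u⁻¹ * v).toWord.length : ℝ) := by
  have h := treeSum_list e he (u⁻¹ * v).toWord u
  rwa [FreeGroup.mk_toWord, mul_inv_cancel_left] at h

/-- In the free group on `n` generators with its word metric
`d(g,h) = |g⁻¹h|` (length of the reduced word), consider the set `E` of directed edges
`(g,h)` of the Cayley graph with `d(g,h) = 1` and `|g| = |h| + 1`.  For any finitely supported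
`a : E → ℝ`, the supremum of `∑ a(g,h)·(f g − f h)` over all `1`-Lipschitz `f` vanishing at the
identity equals `∑ |a(g,h)|`. -/
theorem free_group_edge_vectors_isometric_l1
    {n : ℕ} (hn : 1 ≤ n)
    (a : (FreeGroup (Fin n) × FreeGroup (Fin n)) →₀ ℝ)
    (ha : ∀ p ∈ a.support,
      ((p.1⁻¹ * p.2).toWord.length = 1 ∧
        (p.1).toWord.length = (p.2).toWord.length + 1)) :
    sSup {r : ℝ | ∃ f : FreeGroup (Fin n) → ℝ,
        f 1 = 0 ∧
        (∀ u v : FreeGroup (Fin n), |f u - f v| ≤ ((u⁻¹ * v).toWord.length : ℝ)) ∧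
        r = ∑ p ∈ a.support, a p * (f p.1 - f p.2)}
      = ∑ p ∈ a.support, |a p| := by
  classical
  let e : FreeGroup (Fin n) → FreeGroup (Fin n) → ℝ := fun g h => SignType.sign (a (g, h))
  have he : ∀ g h, |e g h| ≤ 1 := by
    intro g h
    simp only [e]
    rcases lt_trichotomy (a (g, h)) 0 with h1 | h1 | h1 <;> simp [h1]
  apply le_antisymm
  · apply Real.sSup_le
    · rintro r ⟨f, -, hf, rfl⟩
      apply Finset.sum_le_sum
      intro p hp
      have h1 := hf p.1 p.2
      rw [(ha p hp).1] at h1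
      calc a p * (f p.1 - f p.2) ≤ |a p * (f p.1 - f p.2)| := le_abs_self _
        _ = |a p| * |f p.1 - f p.2| := abs_mul _ _
        _ ≤ |a p| * 1 := by gcongr; simpa using h1
        _ = |a p| := mul_one _
    · exact Finset.sum_nonneg fun _ _ => abs_nonneg _
  · apply le_csSup
    · refine ⟨∑ p ∈ a.support, |a p|, ?_⟩
      rintro r ⟨f, -, hf, rfl⟩
      apply Finset.sum_le_sum
      intro p hp
      have h1 := hf p.1 p.2
      rw [(ha p hp).1] at h1
      calc a p * (f p.1 - f p.2) ≤ |a p * (f p.1 - f p.2)| := le_abs_self _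
        _ = |a p| * |f p.1 - f p.2| := abs_mul _ _
        _ ≤ |a p| * 1 := by gcongr; simpa using h1
        _ = |a p| := mul_one _
    · refine ⟨treeSum e, by simp [treeSum], treeSum_lipschitz e he, ?_⟩
      apply Finset.sum_congr rfl
      intro p hp
      obtain ⟨h1, h2⟩ := ha p hp
      obtain ⟨s, hs⟩ := List.length_eq_one_iff.1 h1
      have h3 : p.2 = p.1 * FreeGroup.mk [s] := by
        rw [← hs, FreeGroup.mk_toWord]; group
      have h4 : p.1.toWord = p.2.toWord ++ [(s.1, !s.2)] := by
        rcases toWord_mul_letter p.1 s with h | h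
        · rw [← h3] at h
          rw [h] at h2
          simp at h2
          omega
        · rw [← h3] at h
          exact h
      rw [treeSum_of_append e _ _ _ h4, add_sub_cancel_left]
      simp [e]
end
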